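/- arXiv:math/0203249 — 8 statements merged into one kernel-verified Lean document; each statement's English description precedes it below -/
import Mathlib

section
/- Let ρ : A → P be a basic scaling. If ρ(x) ≤ ρ(y) and y ∧ z = 0, then ρ(x ∨ z) ≤ ρ(y ∨ z); and if ρ(x) < ρ(y) and y ∧ z = 0, then ρ(x ∨ z) < ρ(y ∨ z). -/
/-- A *basic scaling* is a strictly increasing map from a Boolean algebra to a
partially ordered set that preserves relative complementation. -/
structure IsBasicScaling {A P : Type*} [BooleanAlgebra A] [PartialOrder P]
    (ρ : A → P) : Prop where
  mono : ∀ x y : A, x < y → ρ x < ρ y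
  relcomp_lt : ∀ a b x y : A, a ≤ x → x ≤ b → a ≤ y → y ≤ b →
      ρ x < ρ y → ρ (a ⊔ (b ⊓ yᶜ)) < ρ (a ⊔ (b ⊓ xᶜ))
  relcomp_eq : ∀ a b x y : A, a ≤ x → x ≤ b → a ≤ y → y ≤ b →
      ρ x = ρ y → ρ (a ⊔ (b ⊓ xᶜ)) = ρ (a ⊔ (b ⊓ yᶜ))

/-- A basic scaling is *divided* if whenever `ρ x < ρ y` there is `y₁ < y`
with `ρ y₁ = ρ x`. -/
def Divided {A P : Type*} [BooleanAlgebra A] [PartialOrder P] (ρ : A → P) : Prop :=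
  ∀ x y : A, ρ x < ρ y → ∃ y₁, y₁ < y ∧ ρ y₁ = ρ x

namespace IsBasicScaling

variable {A P : Type*} [BooleanAlgebra A] [PartialOrder P] {ρ : A → P}

theorem monotone (h : IsBasicScaling ρ) : Monotone ρ :=
  StrictMono.monotone fun x y => h.mono x y

theorem lt_sup_of_disjoint (h : IsBasicScaling ρ) {x y z : A} (hx : Disjoint x z)
    (hy : Disjoint y z) (hxy : ρ x < ρ y) : ρ (x ⊔ z) < ρ (y ⊔ z) := by
  have hc := h.relcomp_lt ⊥ zᶜ x y bot_le hx.le_compl_right bot_le hy.le_compl_right hxy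
  simpa [compl_inf, sup_comm] using
    h.relcomp_lt ⊥ ⊤ _ _ bot_le le_top bot_le le_top hc

theorem eq_sup_of_disjoint (h : IsBasicScaling ρ) {x y z : A} (hx : Disjoint x z)
    (hy : Disjoint y z) (hxy : ρ x = ρ y) : ρ (x ⊔ z) = ρ (y ⊔ z) := by
  have hc := h.relcomp_eq ⊥ zᶜ x y bot_le hx.le_compl_right bot_le hy.le_compl_right hxy
  simpa [compl_inf, sup_comm] using
    h.relcomp_eq ⊥ ⊤ _ _ bot_le le_top bot_le le_top hc

end IsBasicScaling

theorem stmt_0 {A P : Type*} [BooleanAlgebra A] [PartialOrder P] (ρ : A → P)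
    (h : IsBasicScaling ρ) (x y z : A) (hyz : y ⊓ z = ⊥) :
    (ρ x ≤ ρ y → ρ (x ⊔ z) ≤ ρ (y ⊔ z)) ∧
    (ρ x < ρ y → ρ (x ⊔ z) < ρ (y ⊔ z)) := by
  have hy : Disjoint y z := disjoint_iff.mpr hyz
  have hx : Disjoint (x \ z) z := disjoint_sdiff_self_left
  have hle : ρ (x \ z) ≤ ρ x := h.monotone sdiff_le
  rw [← sdiff_sup_self z x]
  refine ⟨fun hxy => ?_, fun hxy => h.lt_sup_of_disjoint hx hy (hle.trans_lt hxy)⟩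
  rcases (hle.trans hxy).lt_or_eq with hlt | heq
  · exact (h.lt_sup_of_disjoint hx hy hlt).le
  · exact (h.eq_sup_of_disjoint hx hy heq).le
end

section
/- Let ρ : A → P be a basic scaling. If u ∧ v = 0, x ∧ y = 0, ρ(u) = ρ(x), and ρ(v) = ρ(y), then ρ(u ∨ v) = ρ(x ∨ y). (Hence for disjoint elements, ρ(x ∨ y) depends on x and y only through ρ(x) and ρ(y), so a sum ρ(x) + ρ(y) := ρ(x ∨ y) is unambiguously defined.) -/
lemma inf_sup_inf_compl_eq_of_disjoint {A : Type*} [BooleanAlgebra A] {x z : A} (y : A)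
    (hxz : Disjoint x z) : x ⊓ y ⊔ (x ⊔ y ⊔ z) ⊓ xᶜ = y ⊔ z := by
  rw [inf_sup_right, inf_sup_right, inf_compl_self, bot_sup_eq,
    inf_eq_left.2 hxz.symm.le_compl_right, ← sup_assoc, inf_comm x y, sup_inf_inf_compl]

/-- A basic scaling is compatible with joining a disjoint element. -/
lemma IsBasicScaling.map_sup_right_congr {A P : Type*} [BooleanAlgebra A] [PartialOrder P]
    {ρ : A → P} (h : IsBasicScaling ρ) {x y z : A} (hxz : Disjoint x z) (hyz : Disjoint y z)
    (hxy : ρ x = ρ y) : ρ (x ⊔ z) = ρ (y ⊔ z) := by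
  have key := h.relcomp_eq (x ⊓ y) (x ⊔ y ⊔ z) x y inf_le_left
    (le_sup_left.trans le_sup_left) inf_le_right (le_sup_right.trans le_sup_left) hxy
  rw [inf_sup_inf_compl_eq_of_disjoint y hxz, inf_comm x y, sup_comm x y,
    inf_sup_inf_compl_eq_of_disjoint x hyz] at key
  exact key.symm

theorem stmt_1 {A P : Type*} [BooleanAlgebra A] [PartialOrder P] (ρ : A → P)
    (h : IsBasicScaling ρ) (u v x y : A)
    (huv : u ⊓ v = ⊥) (hxy : x ⊓ y = ⊥)
    (hux : ρ u = ρ x) (hvy : ρ v = ρ y) :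
    ρ (u ⊔ v) = ρ (x ⊔ y) := by
  have duv : Disjoint u v := disjoint_iff.2 huv
  have dxy : Disjoint x y := disjoint_iff.2 hxy
  -- Exchange `u` for `x` and then `v` for `y`, leaving the overlap `v ⊓ x` aside.
  have exchange : ρ (u ⊔ v \ x) = ρ (y ⊔ x \ v) := by
    calc ρ (u ⊔ v \ x) = ρ (x ⊔ v \ x) :=
          h.map_sup_right_congr (duv.mono_right sdiff_le) disjoint_sdiff_self_right hux
      _ = ρ (v ⊔ x \ v) := by rw [sup_sdiff_self_right, sup_sdiff_self_right, sup_comm]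
      _ = ρ (y ⊔ x \ v) :=
          h.map_sup_right_congr disjoint_sdiff_self_right (dxy.symm.mono_right sdiff_le) hvy
  have restore := h.map_sup_right_congr (z := v ⊓ x)
    ((duv.mono_right inf_le_left).sup_left (disjoint_sdiff_self_left.mono_right inf_le_right))
    ((dxy.symm.mono_right inf_le_right).sup_left
      (disjoint_sdiff_self_left.mono_right inf_le_left)) exchange
  rwa [sup_assoc, sup_assoc, sup_comm (v \ x), sup_inf_sdiff, inf_comm v x,
    sup_comm (x \ v), sup_inf_sdiff, sup_comm y x] at restore
end

section
/- Let ρ : A → P be a basic scaling. If x ∧ y = 0, ρ(u) ≤ ρ(x), and ρ(v) ≤ ρ(y), then ρ(u ∨ v) ≤ ρ(x ∨ y). If moreover u ∧ v = 0 and at least one of the two inequalities ρ(u) ≤ ρ(x), ρ(v) ≤ ρ(y) is strict, then ρ(u ∨ v) < ρ(x ∨ y). -/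
namespace IsBasicScaling

variable {A P : Type*} [BooleanAlgebra A] [PartialOrder P] {ρ : A → P}

theorem sdiff_lt_sdiff (h : IsBasicScaling ρ) {b x y : A} (hx : x ≤ b) (hy : y ≤ b)
    (hxy : ρ x < ρ y) : ρ (b \ y) < ρ (b \ x) := by
  simpa [sdiff_eq] using h.relcomp_lt ⊥ b x y bot_le hx bot_le hy hxy

theorem sdiff_eq_sdiff (h : IsBasicScaling ρ) {b x y : A} (hx : x ≤ b) (hy : y ≤ b)
    (hxy : ρ x = ρ y) : ρ (b \ x) = ρ (b \ y) := by
  simpa [sdiff_eq] using h.relcomp_eq ⊥ b x y bot_le hx bot_le hy hxy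

theorem sup_sup_sdiff_sdiff {x y z : A} (hyz : Disjoint y z) :
    (x ⊔ y ⊔ z) \ (y \ x) = x ⊔ z := by
  rw [sup_sdiff, (hyz.symm.mono_right sdiff_le).sdiff_eq_left, sup_sdiff,
    disjoint_sdiff_self_right.sdiff_eq_left, sdiff_sdiff_right_self,
    sup_eq_left.2 (inf_le_right : y ⊓ x ≤ x)]

theorem sup_lt_sup_right (h : IsBasicScaling ρ) {x y z : A} (hxz : Disjoint x z)
    (hyz : Disjoint y z) (hxy : ρ x < ρ y) : ρ (x ⊔ z) < ρ (y ⊔ z) := by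
  have hd : ρ (x \ y) < ρ (y \ x) := by
    simpa using h.sdiff_lt_sdiff (b := x ⊔ y) le_sup_left le_sup_right hxy
  have hs := h.sdiff_lt_sdiff (b := x ⊔ y ⊔ z)
    (sdiff_le.trans (le_sup_left.trans le_sup_left))
    (sdiff_le.trans (le_sup_right.trans le_sup_left)) hd
  rwa [sup_sup_sdiff_sdiff hyz, sup_comm x y, sup_sup_sdiff_sdiff hxz] at hs

theorem sup_eq_sup_right (h : IsBasicScaling ρ) {x y z : A} (hxz : Disjoint x z)
    (hyz : Disjoint y z) (hxy : ρ x = ρ y) : ρ (x ⊔ z) = ρ (y ⊔ z) := by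
  have hd : ρ (y \ x) = ρ (x \ y) := by
    simpa using h.sdiff_eq_sdiff (b := x ⊔ y) le_sup_left le_sup_right hxy
  have hs := h.sdiff_eq_sdiff (b := x ⊔ y ⊔ z)
    (sdiff_le.trans (le_sup_right.trans le_sup_left))
    (sdiff_le.trans (le_sup_left.trans le_sup_left)) hd
  rwa [sup_sup_sdiff_sdiff hyz, sup_comm x y, sup_sup_sdiff_sdiff hxz] at hs

theorem sup_le_sup_right (h : IsBasicScaling ρ) {x y z : A} (hxz : Disjoint x z)
    (hyz : Disjoint y z) (hxy : ρ x ≤ ρ y) : ρ (x ⊔ z) ≤ ρ (y ⊔ z) :=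
  hxy.lt_or_eq.elim (fun hlt => (h.sup_lt_sup_right hxz hyz hlt).le)
    fun heq => (h.sup_eq_sup_right hxz hyz heq).le

theorem sup_le_sup_of_disjoint (h : IsBasicScaling ρ) {u v x y : A} (huv : Disjoint u v)
    (hxy : Disjoint x y) (hux : ρ u ≤ ρ x) (hvy : ρ v ≤ ρ y) :
    ρ (u ⊔ v) ≤ ρ (x ⊔ y) ∧ (ρ u < ρ x ∨ ρ v < ρ y → ρ (u ⊔ v) < ρ (x ⊔ y)) := by
  have hu : Disjoint u (v \ x) := huv.mono_right sdiff_le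
  have hx : Disjoint x (v \ x) := disjoint_sdiff_self_right
  have hv : Disjoint v (x \ v) := disjoint_sdiff_self_right
  have hy : Disjoint y (x \ v) := hxy.symm.mono_right sdiff_le
  have hmid : x ⊔ v \ x = v ⊔ x \ v := by
    rw [sup_sdiff_self_right, sup_sdiff_self_right, sup_comm]
  have hl : Disjoint (u ⊔ v \ x) (v ⊓ x) :=
    (huv.mono_right inf_le_left).sup_left (disjoint_sdiff_self_left.mono_right inf_le_right)
  have hr : Disjoint (y ⊔ x \ v) (v ⊓ x) :=
    (hxy.symm.mono_right inf_le_right).sup_left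
      (disjoint_sdiff_self_left.mono_right inf_le_left)
  have hul : u ⊔ v \ x ⊔ v ⊓ x = u ⊔ v := by rw [sup_assoc, sup_comm (v \ x), sup_inf_sdiff]
  have hyr : y ⊔ x \ v ⊔ v ⊓ x = x ⊔ y := by
    rw [sup_assoc, inf_comm, sup_comm (x \ v), sup_inf_sdiff, sup_comm]
  have hux' := h.sup_le_sup_right hu hx hux
  have hvy' := h.sup_le_sup_right hv hy hvy
  rw [hmid] at hux'
  rw [← hul, ← hyr]
  refine ⟨h.sup_le_sup_right hl hr (hux'.trans hvy'), fun hlt =>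
    h.sup_lt_sup_right hl hr ?_⟩
  rcases hlt with hlt | hlt
  · exact (hmid ▸ h.sup_lt_sup_right hu hx hlt).trans_le hvy'
  · exact hux'.trans_lt (h.sup_lt_sup_right hv hy hlt)

end IsBasicScaling

theorem stmt_2 {A P : Type*} [BooleanAlgebra A] [PartialOrder P] (ρ : A → P)
    (h : IsBasicScaling ρ) (u v x y : A)
    (hxy : x ⊓ y = ⊥) (hux : ρ u ≤ ρ x) (hvy : ρ v ≤ ρ y) :
    ρ (u ⊔ v) ≤ ρ (x ⊔ y) ∧
    (u ⊓ v = ⊥ → (ρ u < ρ x ∨ ρ v < ρ y) → ρ (u ⊔ v) < ρ (x ⊔ y)) := by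
  have hdisj := disjoint_iff.2 hxy
  refine ⟨?_, fun huv => (h.sup_le_sup_of_disjoint (disjoint_iff.2 huv) hdisj hux hvy).2⟩
  rw [← sup_sdiff_self_right]
  exact (h.sup_le_sup_of_disjoint disjoint_sdiff_self_right hdisj hux
    ((h.monotone sdiff_le).trans hvy)).1
end

section
/- Let ρ : A → P be a basic scaling. If u ∨ v = 1, x ∨ y = 1, ρ(u) = ρ(x), and ρ(v) = ρ(y), then ρ(u ∧ v) = ρ(x ∧ y). (Hence a dual-sum ρ(x) ⊕ ρ(y) := ρ(x ∧ y), for x ∨ y = 1, is unambiguously defined.) -/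
theorem inf_sup_inf_compl_eq_sup {A : Type*} [BooleanAlgebra A] {p q c : A}
    (hpc : Disjoint p c) : (p ⊓ q) ⊔ ((p ⊔ q ⊔ c) ⊓ pᶜ) = q ⊔ c := by
  have hc : c ⊓ pᶜ = c := inf_eq_left.2 hpc.symm.le_compl_right
  rw [inf_sup_right, inf_sup_right, inf_compl_self, bot_sup_eq, hc, ← sup_assoc,
    inf_comm p q, ← inf_sup_left, sup_compl_eq_top, inf_top_eq]

namespace IsBasicScaling

variable {A P : Type*} [BooleanAlgebra A] [PartialOrder P] {ρ : A → P}

theorem map_compl_eq (h : IsBasicScaling ρ) {p q : A} (hpq : ρ p = ρ q) : ρ pᶜ = ρ qᶜ := by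
  simpa using h.relcomp_eq ⊥ ⊤ p q bot_le le_top bot_le le_top hpq

theorem map_sup_right_eq (h : IsBasicScaling ρ) {p q c : A} (hpc : Disjoint p c)
    (hqc : Disjoint q c) (hpq : ρ p = ρ q) : ρ (p ⊔ c) = ρ (q ⊔ c) := by
  have key := h.relcomp_eq (p ⊓ q) (p ⊔ q ⊔ c) p q inf_le_left
    (le_sup_left.trans le_sup_left) inf_le_right (le_sup_right.trans le_sup_left) hpq
  rw [inf_sup_inf_compl_eq_sup hpc, inf_comm p q, sup_comm p q,
    inf_sup_inf_compl_eq_sup hqc] at key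
  exact key.symm

/-- The value of a basic scaling at a disjoint join depends only on the values at the parts. -/
theorem map_sup_eq (h : IsBasicScaling ρ) {p q r s : A} (hpq : Disjoint p q)
    (hrs : Disjoint r s) (hpr : ρ p = ρ r) (hqs : ρ q = ρ s) : ρ (p ⊔ q) = ρ (r ⊔ s) := by
  have h₁ : ρ (p ⊔ q \ r) = ρ (r ⊔ q \ r) :=
    h.map_sup_right_eq (hpq.mono_right sdiff_le) disjoint_sdiff_self_right hpr
  have h₂ : ρ (q ⊔ r \ q) = ρ (s ⊔ r \ q) :=
    h.map_sup_right_eq disjoint_sdiff_self_right (hrs.symm.mono_right sdiff_le) hqs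
  have h₃ : ρ (p ⊔ q \ r) = ρ (s ⊔ r \ q) := by
    rw [h₁, ← h₂, sup_sdiff_self_right, sup_sdiff_self_right, sup_comm]
  have h₄ := h.map_sup_right_eq (c := q ⊓ r)
    ((hpq.mono_right inf_le_left).sup_left (disjoint_sdiff_self_left.mono_right inf_le_right))
    ((hrs.symm.mono_right inf_le_right).sup_left
      (disjoint_sdiff_self_left.mono_right inf_le_left)) h₃
  rwa [sup_assoc, sup_assoc, sup_comm (q \ r), sup_inf_sdiff, inf_comm q r, sup_comm (r \ q),
    sup_inf_sdiff, sup_comm s] at h₄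

end IsBasicScaling

theorem stmt_3 {A P : Type*} [BooleanAlgebra A] [PartialOrder P] (ρ : A → P)
    (h : IsBasicScaling ρ) (u v x y : A)
    (huv : u ⊔ v = ⊤) (hxy : x ⊔ y = ⊤)
    (hux : ρ u = ρ x) (hvy : ρ v = ρ y) :
    ρ (u ⊓ v) = ρ (x ⊓ y) := by
  have hdisj : ∀ {a b : A}, a ⊔ b = ⊤ → Disjoint aᶜ bᶜ := fun hab => by
    rw [disjoint_iff, ← compl_sup, hab, compl_top]
  simpa using h.map_compl_eq
    (h.map_sup_eq (hdisj huv) (hdisj hxy) (h.map_compl_eq hux) (h.map_compl_eq hvy))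
end

section
/- (de Morgan laws for scales) Let ρ : A → P be a basic scaling. (a) If x ∧ y = 0 and u, v ∈ A satisfy u ∨ v = 1, ρ(u) = ρ(xᶜ), and ρ(v) = ρ(yᶜ), then ρ(u ∧ v) = ρ((x ∨ y)ᶜ). (b) If x ∨ y = 1 and u, v ∈ A satisfy u ∧ v = 0, ρ(u) = ρ(xᶜ), and ρ(v) = ρ(yᶜ), then ρ(u ∨ v) = ρ((x ∧ y)ᶜ). (In sum-notation: ∼(ζ + η) = (∼ζ) ⊕ (∼η) and ∼(ζ ⊕ η) = (∼ζ) + (∼η), existence of one side entailing that of the other.) -/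
/-- Homomorphisms to `Prop` separate the points of a bounded distributive lattice. -/
theorem eq_of_forall_boundedLatticeHom_prop {A : Type*} [DistribLattice A] [BoundedOrder A]
    {a b : A} (hab : ∀ f : BoundedLatticeHom A Prop, f a ↔ f b) : a = b := by
  have le_of_forall : ∀ {c d : A}, (∀ f : BoundedLatticeHom A Prop, f c → f d) → c ≤ d := by
    intro c d hcd
    by_contra hle
    have hdisj : Disjoint (Order.PFilter.principal c : Set A) (Order.Ideal.principal d : Set A) := by
      rw [Set.disjoint_left]
      intro z hz hz'
      exact hle (le_trans (Order.PFilter.mem_principal.1 hz) (Order.Ideal.mem_principal.1 hz'))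
    obtain ⟨J, hJ, hdJ, hcJ⟩ := DistribLattice.prime_ideal_of_disjoint_filter_ideal hdisj
    let f : BoundedLatticeHom A Prop :=
      { toFun := fun z => z ∉ J
        map_sup' := fun x y => by
          simp only [Order.Ideal.sup_mem_iff, sup_Prop_eq, eq_iff_iff]
          tauto
        map_inf' := fun x y => by
          have hinf : x ⊓ y ∈ J ↔ x ∈ J ∨ y ∈ J :=
            ⟨hJ.mem_or_mem, fun h => h.elim (J.lower inf_le_left) (J.lower inf_le_right)⟩
          simp only [hinf, inf_Prop_eq, eq_iff_iff]
          tauto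
        map_top' := by simpa using hJ.toIsProper.top_notMem
        map_bot' := by simp }
    exact hcd f (fun hc => Set.disjoint_left.1 hcJ (Order.PFilter.mem_principal.2 le_rfl) hc)
      (hdJ (Order.Ideal.mem_principal.2 le_rfl))
  exact le_antisymm (le_of_forall fun f => (hab f).1) (le_of_forall fun f => (hab f).2)

namespace IsBasicScaling

variable {A P : Type*} [BooleanAlgebra A] [PartialOrder P] {ρ : A → P}

theorem compl_congr (h : IsBasicScaling ρ) {s t : A} (hst : ρ s = ρ t) : ρ sᶜ = ρ tᶜ := by
  simpa using h.relcomp_eq ⊥ ⊤ s t bot_le le_top bot_le le_top hst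

theorem sup_congr_left (h : IsBasicScaling ρ) {s t z : A} (hs : Disjoint s z)
    (ht : Disjoint t z) (hst : ρ s = ρ t) : ρ (s ⊔ z) = ρ (t ⊔ z) := by
  have hc := h.compl_congr <| h.relcomp_eq ⊥ zᶜ s t bot_le hs.le_compl_right bot_le
    ht.le_compl_right hst
  simpa [sup_comm] using hc

theorem of_sup_eq_sup_right (h : IsBasicScaling ρ) {s t z : A} (hs : Disjoint s z)
    (ht : Disjoint t z) (hst : ρ (s ⊔ z) = ρ (t ⊔ z)) : ρ s = ρ t := by
  have hc := h.compl_congr <| h.relcomp_eq z ⊤ (s ⊔ z) (t ⊔ z) le_sup_right le_top le_sup_right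
    le_top hst
  have key : ∀ r : A, Disjoint r z → (z ⊔ ⊤ ⊓ (r ⊔ z)ᶜ)ᶜ = r := fun r hr => by
    simp only [top_inf_eq, compl_sup, compl_inf, compl_compl, inf_sup_left,
      sup_bot_eq, inf_comm zᶜ r, inf_comm zᶜ z, inf_compl_self]
    exact inf_eq_left.2 hr.le_compl_right
  rwa [key s hs, key t ht] at hc

theorem sdiff_congr (h : IsBasicScaling ρ) {s t : A} (hst : ρ s = ρ t) :
    ρ (s \ t) = ρ (t \ s) := by
  refine h.of_sup_eq_sup_right (z := s ⊓ t)
    (disjoint_sdiff_self_left.mono le_rfl inf_le_right)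
    (disjoint_sdiff_self_left.mono le_rfl inf_le_left) ?_
  rwa [sup_comm, sup_inf_sdiff, inf_comm, sup_comm, sup_inf_sdiff]

/-- The sum of scale values is well defined. -/
theorem sup_congr (h : IsBasicScaling ρ) {u v p q : A} (huv : Disjoint u v)
    (hpq : Disjoint p q) (hu : ρ u = ρ p) (hv : ρ v = ρ q) : ρ (u ⊔ v) = ρ (p ⊔ q) := by
  have huv' : ∀ f : BoundedLatticeHom A Prop, ¬ (f u ∧ f v) := fun f => by
    simpa using congrArg f huv.eq_bot
  have hpq' : ∀ f : BoundedLatticeHom A Prop, ¬ (f p ∧ f q) := fun f => by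
    simpa using congrArg f hpq.eq_bot
  have h₁ : ρ (u \ p ⊔ v \ (p ⊔ q)) = ρ (p \ u ⊔ v \ (p ⊔ q)) :=
    h.sup_congr_left (huv.mono sdiff_le sdiff_le)
      (disjoint_sdiff_self_right.mono (sdiff_le.trans le_sup_left) le_rfl) (h.sdiff_congr hu)
  have h₂ : ρ (v \ q ⊔ p \ (u ⊔ v)) = ρ (q \ v ⊔ p \ (u ⊔ v)) :=
    h.sup_congr_left (disjoint_sdiff_self_right.mono (sdiff_le.trans le_sup_right) le_rfl)
      (hpq.symm.mono sdiff_le sdiff_le) (h.sdiff_congr hv)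
  have e₁ : p \ u ⊔ v \ (p ⊔ q) = v \ q ⊔ p \ (u ⊔ v) := by
    refine eq_of_forall_boundedLatticeHom_prop fun f => ?_
    have := huv' f
    have := hpq' f
    simp only [map_sup, map_inf, sdiff_eq, map_compl', sup_Prop_eq, inf_Prop_eq, compl_iff_not]
    tauto
  have e₂ : u \ p ⊔ v \ (p ⊔ q) = (u ⊔ v) \ (p ⊔ q) ⊔ u ⊓ q := by
    refine eq_of_forall_boundedLatticeHom_prop fun f => ?_
    have := huv' f
    have := hpq' f
    simp only [map_sup, map_inf, sdiff_eq, map_compl', sup_Prop_eq, inf_Prop_eq, compl_iff_not]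
    tauto
  have e₃ : q \ v ⊔ p \ (u ⊔ v) = (p ⊔ q) \ (u ⊔ v) ⊔ u ⊓ q := by
    refine eq_of_forall_boundedLatticeHom_prop fun f => ?_
    have := huv' f
    have := hpq' f
    simp only [map_sup, map_inf, sdiff_eq, map_compl', sup_Prop_eq, inf_Prop_eq, compl_iff_not]
    tauto
  have h₃ : ρ ((u ⊔ v) \ (p ⊔ q)) = ρ ((p ⊔ q) \ (u ⊔ v)) := by
    refine h.of_sup_eq_sup_right (z := u ⊓ q)
      (disjoint_sdiff_self_left.mono le_rfl (inf_le_right.trans le_sup_right))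
      (disjoint_sdiff_self_left.mono le_rfl (inf_le_left.trans le_sup_left)) ?_
    rw [← e₂, ← e₃, h₁, e₁, h₂]
  have h₄ := h.sup_congr_left (z := (u ⊔ v) ⊓ (p ⊔ q))
    (disjoint_sdiff_self_left.mono le_rfl inf_le_right)
    (disjoint_sdiff_self_left.mono le_rfl inf_le_left) h₃
  rwa [sup_comm (_ \ _), sup_inf_sdiff, inf_comm, sup_comm (_ \ _), sup_inf_sdiff] at h₄

end IsBasicScaling

theorem stmt_8 {A P : Type*} [BooleanAlgebra A] [PartialOrder P] (ρ : A → P)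
    (h : IsBasicScaling ρ) (x y : A) :
    (x ⊓ y = ⊥ → ∀ u v : A, u ⊔ v = ⊤ → ρ u = ρ xᶜ → ρ v = ρ yᶜ →
      ρ (u ⊓ v) = ρ (x ⊔ y)ᶜ) ∧
    (x ⊔ y = ⊤ → ∀ u v : A, u ⊓ v = ⊥ → ρ u = ρ xᶜ → ρ v = ρ yᶜ →
      ρ (u ⊔ v) = ρ (x ⊓ y)ᶜ) := by
  refine ⟨fun hxy u v huv hu hv => ?_, fun hxy u v huv hu hv => ?_⟩
  · have huv' : Disjoint uᶜ vᶜ := by rw [disjoint_iff, ← compl_sup, huv, compl_top]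
    have hs := h.sup_congr huv' (disjoint_iff.2 hxy)
      (by simpa using h.compl_congr hu) (by simpa using h.compl_congr hv)
    simpa only [compl_sup, compl_compl] using h.compl_congr hs
  · have hxy' : Disjoint xᶜ yᶜ := by rw [disjoint_iff, ← compl_sup, hxy, compl_top]
    rw [compl_inf]
    exact h.sup_congr (disjoint_iff.2 huv) hxy' hu hv
end

section
/- Let S be a finite set, A the Boolean algebra of all subsets of S, and ρ : A → P a divided basic scaling. Then for all T₁, T₂ ⊆ S: if ρ(T₁) = ρ(T₂) then |T₁| = |T₂|, and if ρ(T₁) < ρ(T₂) then |T₁| < |T₂|. -/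
/-- For a strictly increasing divided map on subsets of a finite set, sets of equal value have
cardinalities bounded by each other. -/
theorem Divided.ncard_le_of_eq {S P : Type*} [Finite S] [PartialOrder P] {ρ : Set S → P}
    (hdiv : Divided ρ) (hρ : StrictMono ρ) {T U : Set S} (hTU : ρ T = ρ U) :
    T.ncard ≤ U.ncard := by
  induction T, T.toFinite using Set.Finite.induction_on generalizing U with
  | empty => simp
  | @insert a T ha hT ih =>
    obtain ⟨V, hVU, hV⟩ := hdiv T U (hTU ▸ hρ (Set.ssubset_insert ha))
    rw [Set.ncard_insert_of_notMem ha hT]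
    exact (ih hV.symm).trans_lt (Set.ncard_lt_ncard hVU)

theorem stmt_12 {S P : Type*} [Fintype S] [PartialOrder P] (ρ : Set S → P)
    (h : IsBasicScaling ρ) (hdiv : Divided ρ) (T₁ T₂ : Set S) :
    (ρ T₁ = ρ T₂ → T₁.ncard = T₂.ncard) ∧
    (ρ T₁ < ρ T₂ → T₁.ncard < T₂.ncard) := by
  have hρ : StrictMono ρ := h.mono
  refine ⟨fun he => le_antisymm (hdiv.ncard_le_of_eq hρ he) (hdiv.ncard_le_of_eq hρ he.symm),
    fun hlt => ?_⟩
  obtain ⟨V, hV, he⟩ := hdiv T₁ T₂ hlt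
  exact (hdiv.ncard_le_of_eq hρ he.symm).trans_lt (Set.ncard_lt_ncard hV)
end

section
/- Let S be a finite set, A the Boolean algebra of all subsets of S, and ρ : A → P a divided basic scaling. Then there is a partition of S, i.e., a natural number k and a surjective map f : S → {1, …, k}, such that for all T₁, T₂ ⊆ S: ρ(T₁) ≤ ρ(T₂) if and only if |T₁ ∩ f⁻¹(i)| ≤ |T₂ ∩ f⁻¹(i)| for every i ∈ {1, …, k}. -/
namespace IsBasicScaling

section BooleanAlgebra

variable {A P : Type*} [BooleanAlgebra A] [PartialOrder P] {ρ : A → P}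

theorem eq_iff_sdiff (h : IsBasicScaling ρ) (x y : A) :
    ρ x = ρ y ↔ ρ (x \ y) = ρ (y \ x) := by
  have key : ∀ u v : A, u ≤ x ⊔ y → v ≤ x ⊔ y → ρ u = ρ v →
      ρ ((x ⊔ y) \ u) = ρ ((x ⊔ y) \ v) := fun u v hu hv huv => by
    simpa [sdiff_eq] using h.relcomp_eq ⊥ (x ⊔ y) u v bot_le hu bot_le hv huv
  constructor
  · intro hxy
    have := key x y le_sup_left le_sup_right hxy
    rw [sup_sdiff_left_self, sup_sdiff_right_self] at this
    exact this.symm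
  · intro hxy
    have := key (x \ y) (y \ x) (sdiff_le.trans le_sup_left) (sdiff_le.trans le_sup_right) hxy
    have hx : (x ⊔ y) \ (x \ y) = y := by
      rw [← sup_sdiff_right_self (a := x) (b := y), sdiff_sdiff_eq_self le_sup_right]
    have hy : (x ⊔ y) \ (y \ x) = x := by
      rw [← sup_sdiff_left_self (a := x) (b := y), sdiff_sdiff_eq_self le_sup_left]
    rw [hx, hy] at this
    exact this.symm

theorem eq_bot_of_map_eq (h : IsBasicScaling ρ) {x : A} (hx : ρ x = ρ ⊥) : x = ⊥ := by
  by_contra hne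
  exact (h.mono _ _ (bot_lt_iff_ne_bot.2 hne)).ne' hx

end BooleanAlgebra

section Set

variable {S P : Type*} [PartialOrder P] {ρ : Set S → P}

theorem exists_eq_singleton (h : IsBasicScaling ρ) (hdiv : Divided ρ) {Y : Set S} {s : S}
    (hY : ρ Y = ρ {s}) : ∃ t, Y = {t} := by
  rcases Y.eq_empty_or_nonempty with rfl | ⟨t, ht⟩
  · exact absurd (h.eq_bot_of_map_eq hY.symm) (Set.singleton_ne_empty s)
  refine ⟨t, ?_⟩
  by_contra hne
  have hlt : ρ {t} < ρ {s} :=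
    hY ▸ h.mono _ _ ((Set.singleton_subset_iff.2 ht).lt_of_ne (Ne.symm hne))
  obtain ⟨Z, hZ, hρ⟩ := hdiv _ _ hlt
  rw [Set.ssubset_singleton_iff] at hZ
  subst hZ
  exact Set.singleton_ne_empty t (h.eq_bot_of_map_eq hρ.symm)

theorem exists_mem_map_singleton_eq (h : IsBasicScaling ρ) (hdiv : Divided ρ) {Y : Set S} {s : S}
    (hs : ρ {s} ≤ ρ Y) : ∃ t ∈ Y, ρ {t} = ρ {s} := by
  obtain ⟨Z, hZY, hZ⟩ : ∃ Z ⊆ Y, ρ Z = ρ {s} := by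
    rcases hs.eq_or_lt with heq | hlt
    · exact ⟨Y, subset_rfl, heq.symm⟩
    · obtain ⟨Z, hZ, hρ⟩ := hdiv _ _ hlt
      exact ⟨Z, hZ.le, hρ⟩
  obtain ⟨t, rfl⟩ := h.exists_eq_singleton hdiv hZ
  exact ⟨t, hZY rfl, hZ⟩

theorem eq_iff_diff_singleton_of_mem (h : IsBasicScaling ρ) {X Y : Set S} {s : S}
    (hX : s ∈ X) (hY : s ∈ Y) : ρ X = ρ Y ↔ ρ (X \ {s}) = ρ (Y \ {s}) := by
  rw [h.eq_iff_sdiff X Y, h.eq_iff_sdiff (X \ {s}) (Y \ {s})]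
  have h₁ : (X \ {s}) \ (Y \ {s}) = X \ Y := by grind
  have h₂ : (Y \ {s}) \ (X \ {s}) = Y \ X := by grind
  rw [h₁, h₂]

/-- Elements whose singletons have the same scale can be removed from both sides. -/
theorem eq_iff_diff_singleton (h : IsBasicScaling ρ) {X Y : Set S} {s t : S}
    (hX : s ∈ X) (hY : t ∈ Y) (hst : ρ {t} = ρ {s}) (hs : s ∈ Y → t = s) :
    ρ X = ρ Y ↔ ρ (X \ {s}) = ρ (Y \ {t}) := by
  by_cases hsY : s ∈ Y
  · obtain rfl := hs hsY
    exact h.eq_iff_diff_singleton_of_mem hX hY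
  have hswap : ρ Y = ρ (insert s (Y \ {t})) := by
    rw [h.eq_iff_sdiff]
    have h₁ : Y \ insert s (Y \ {t}) = {t} := by grind
    have h₂ : insert s (Y \ {t}) \ Y = {s} := by grind
    rw [h₁, h₂, hst]
  have h₃ : insert s (Y \ {t}) \ {s} = Y \ {t} := by grind
  rw [hswap, h.eq_iff_diff_singleton_of_mem hX (Set.mem_insert s _), h₃]

end Set

end IsBasicScaling

theorem ncard_inter_preimage_diff_singleton {S ι : Type*} [Finite S] [DecidableEq ι] (f : S → ι)
    {X : Set S} {s : S} (hs : s ∈ X) (i : ι) :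
    (X ∩ f ⁻¹' {i}).ncard = ((X \ {s}) ∩ f ⁻¹' {i}).ncard + if f s = i then 1 else 0 := by
  split_ifs with hi
  · rw [← Set.ncard_sdiff_singleton_add_one (show s ∈ X ∩ f ⁻¹' {i} from ⟨hs, hi⟩)]
    congr 2
    grind
  · congr 1
    ext x
    simp only [Set.mem_inter_iff, Set.mem_preimage, Set.mem_singleton_iff, Set.mem_sdiff]
    grind

theorem IsBasicScaling.eq_iff_ncard {S P ι : Type*} [Finite S] [PartialOrder P] {ρ : Set S → P}
    (h : IsBasicScaling ρ) (hdiv : Divided ρ) (f : S → ι)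
    (hf : ∀ s t, f s = f t ↔ ρ {s} = ρ {t}) (X Y : Set S) :
    ρ X = ρ Y ↔ ∀ i, (X ∩ f ⁻¹' {i}).ncard = (Y ∩ f ⁻¹' {i}).ncard := by
  classical
  induction hn : X.ncard generalizing X Y with
  | zero =>
    obtain rfl : X = ∅ := (Set.ncard_eq_zero).1 hn
    constructor
    · intro hρ
      obtain rfl := h.eq_bot_of_map_eq hρ.symm
      exact fun _ => rfl
    · intro hc
      suffices Y = ∅ by rw [this]
      refine Set.eq_empty_of_forall_notMem fun y hy => ?_
      have := hc (f y)
      rw [Set.empty_inter, Set.ncard_empty, eq_comm, Set.ncard_eq_zero] at this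
      exact this.le ⟨hy, rfl⟩
  | succ n ih =>
    obtain ⟨s, hs⟩ : X.Nonempty := (Set.ncard_pos).1 (by omega)
    have reduce : ∀ t ∈ Y, f t = f s → (s ∈ Y → t = s) →
        (ρ X = ρ Y ↔ ∀ i, (X ∩ f ⁻¹' {i}).ncard = (Y ∩ f ⁻¹' {i}).ncard) := by
      intro t ht hft hsY
      rw [h.eq_iff_diff_singleton hs ht ((hf t s).1 hft) hsY,
        ih _ _ (by rw [Set.ncard_sdiff_singleton_of_mem hs]; omega)]
      simp only [ncard_inter_preimage_diff_singleton f hs,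
        ncard_inter_preimage_diff_singleton f ht, hft, add_left_inj]
    by_cases hsY : s ∈ Y
    · exact reduce s hsY rfl fun _ => rfl
    constructor
    · intro hρ
      obtain ⟨t, ht, hts⟩ := h.exists_mem_map_singleton_eq hdiv
        (hρ ▸ h.monotone (Set.singleton_subset_iff.2 hs))
      exact (reduce t ht ((hf t s).2 hts) fun hmem => absurd hmem hsY).1 hρ
    · intro hc
      have hpos : 0 < (Y ∩ f ⁻¹' {f s}).ncard := by
        rw [← hc, Set.ncard_pos]
        exact ⟨s, hs, rfl⟩
      obtain ⟨t, ht, hts⟩ := (Set.ncard_pos).1 hpos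
      exact (reduce t ht hts fun hmem => absurd hmem hsY).2 hc

theorem exists_subset_ncard_inter_preimage_eq {S ι : Type*} (f : S → ι) (Y : Set S) (c : ι → ℕ)
    (hc : ∀ i, c i ≤ (Y ∩ f ⁻¹' {i}).ncard) :
    ∃ Z ⊆ Y, ∀ i, (Z ∩ f ⁻¹' {i}).ncard = c i := by
  choose Z hZ hcard using fun i => Set.exists_subset_card_eq (hc i)
  refine ⟨⋃ i, Z i, Set.iUnion_subset fun i => (hZ i).trans Set.inter_subset_left, fun i => ?_⟩
  rw [← hcard i]
  congr 1
  ext x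
  simp only [Set.mem_inter_iff, Set.mem_iUnion, Set.mem_preimage, Set.mem_singleton_iff]
  constructor
  · rintro ⟨⟨j, hj⟩, rfl⟩
    obtain rfl : f x = j := (hZ j hj).2
    exact hj
  · exact fun hx => ⟨⟨i, hx⟩, (hZ i hx).2⟩

theorem stmt_13 {S P : Type*} [Fintype S] [PartialOrder P] (ρ : Set S → P)
    (h : IsBasicScaling ρ) (hdiv : Divided ρ) :
    ∃ (k : ℕ) (f : S → Fin k), Function.Surjective f ∧
      ∀ T₁ T₂ : Set S, ρ T₁ ≤ ρ T₂ ↔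
        ∀ i : Fin k, (T₁ ∩ f ⁻¹' {i}).ncard ≤ (T₂ ∩ f ⁻¹' {i}).ncard := by
  let g : S → P := fun s => ρ {s}
  let e := Finite.equivFin (Set.range g)
  let f : S → Fin (Nat.card (Set.range g)) := e ∘ Set.rangeFactorization g
  have hf : ∀ s t, f s = f t ↔ ρ {s} = ρ {t} := fun s t =>
    e.injective.eq_iff.trans Subtype.ext_iff
  refine ⟨_, f, e.surjective.comp Set.rangeFactorization_surjective, fun T₁ T₂ => ⟨?_, ?_⟩⟩
  · intro hle i
    obtain ⟨Z, hZ, hρ⟩ : ∃ Z ⊆ T₂, ρ Z = ρ T₁ := by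
      rcases hle.eq_or_lt with heq | hlt
      · exact ⟨T₂, subset_rfl, heq.symm⟩
      · obtain ⟨Z, hZ, hρ⟩ := hdiv _ _ hlt
        exact ⟨Z, hZ.le, hρ⟩
    rw [← (h.eq_iff_ncard hdiv f hf Z T₁).1 hρ i]
    exact Set.ncard_le_ncard (Set.inter_subset_inter_left _ hZ)
  · intro hc
    obtain ⟨Z, hZ, hcard⟩ := exists_subset_ncard_inter_preimage_eq f T₂ _ hc
    rw [← (h.eq_iff_ncard hdiv f hf Z T₁).2 hcard]
    exact h.monotone hZ
end

section
/- (Uniqueness of the normalized measure) Let ρ : A → L be a basic scaling whose codomain L is linearly ordered. Assume ρ is divided, and Archimedean in the sense that there is no δ in the image of ρ with ρ(0) < δ for which some infinite pairwise disjoint subset X of A satisfies δ ≤ ρ(x) for all x ∈ X. Suppose m₁, m₂ : A → ℝ each satisfy: m(1) = 1; m(x ∨ y) = m(x) + m(y) whenever x ∧ y = 0; and for all x, y ∈ A, m(x) ≤ m(y) if and only if ρ(x) ≤ ρ(y). Then m₁ = m₂. (That is, a linearly ordered divided Archimedean scale carries exactly one measure taking the value 1 at the top element.) -/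
section FinitelyAdditive

variable {A : Type*} [BooleanAlgebra A]

lemma map_bot_of_add {m : A → ℝ} (hadd : ∀ x y : A, x ⊓ y = ⊥ → m (x ⊔ y) = m x + m y) :
    m ⊥ = 0 := by
  have := hadd ⊥ ⊥ (by simp)
  simp only [sup_idem] at this
  linarith

lemma map_sdiff_of_add {m : A → ℝ} (hadd : ∀ x y : A, x ⊓ y = ⊥ → m (x ⊔ y) = m x + m y)
    {x y : A} (hxy : x ≤ y) : m (y \ x) = m y - m x := by
  have := hadd x (y \ x) inf_sdiff_self_right
  rw [sup_sdiff_cancel_right hxy] at this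
  linarith

/-- Euclidean division of values of a measure, carried out simultaneously for a second measure
inducing the same order. -/
lemma exists_common_remainder {m₁ m₂ : A → ℝ}
    (h₁add : ∀ x y : A, x ⊓ y = ⊥ → m₁ (x ⊔ y) = m₁ x + m₁ y)
    (h₂add : ∀ x y : A, x ⊓ y = ⊥ → m₂ (x ⊔ y) = m₂ x + m₂ y)
    (hnonneg : ∀ x, 0 ≤ m₁ x) (heq : ∀ x y, m₁ x = m₁ y → m₂ x = m₂ y)
    (hdiv : ∀ x y, m₁ x < m₁ y → ∃ y' ≤ y, m₁ y' = m₁ x)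
    {x : A} (hx : 0 < m₁ x) (y : A) :
    ∃ (k : ℕ) (z : A), m₁ z < m₁ x ∧ m₁ y = k * m₁ x + m₁ z ∧ m₂ y = k * m₂ x + m₂ z := by
  obtain ⟨n, hn⟩ := exists_nat_gt (m₁ y / m₁ x)
  rw [div_lt_iff₀ hx] at hn
  induction n generalizing y with
  | zero => exact absurd (hnonneg y) (by simpa using hn)
  | succ n ih =>
    rcases lt_trichotomy (m₁ y) (m₁ x) with hlt | he | hgt
    · exact ⟨0, y, hlt, by simp, by simp⟩
    · refine ⟨1, ⊥, ?_, ?_, ?_⟩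
      · rwa [map_bot_of_add h₁add]
      · simp [map_bot_of_add h₁add, he]
      · simp [map_bot_of_add h₂add, heq y x he]
    · obtain ⟨y', hy', hm⟩ := hdiv x y hgt
      have e₁ := map_sdiff_of_add h₁add hy'
      have e₂ := map_sdiff_of_add h₂add hy'
      rw [hm] at e₁
      rw [heq _ _ hm] at e₂
      push_cast at hn
      obtain ⟨k, z, hz, hk₁, hk₂⟩ := ih (y \ y') (by linarith)
      refine ⟨k + 1, z, hz, ?_, ?_⟩ <;> push_cast <;> linarith

/-- The Euclidean algorithm preserves `m₂ x * m₁ y - m₂ y * m₁ x` up to sign, and two of its steps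
halve the larger value. -/
lemma abs_cross_sub_le {m₁ m₂ : A → ℝ}
    (h₁add : ∀ x y : A, x ⊓ y = ⊥ → m₁ (x ⊔ y) = m₁ x + m₁ y)
    (h₂add : ∀ x y : A, x ⊓ y = ⊥ → m₂ (x ⊔ y) = m₂ x + m₂ y)
    (hnonneg : ∀ x, 0 ≤ m₁ x) (hnonneg' : ∀ x, 0 ≤ m₂ x) (hle : ∀ x, m₂ x ≤ 1)
    (heq : ∀ x y, m₁ x = m₁ y → m₂ x = m₂ y)
    (hdiv : ∀ x y, m₁ x < m₁ y → ∃ y' ≤ y, m₁ y' = m₁ x)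
    (n : ℕ) {x y : A} (hxy : m₁ x ≤ m₁ y) :
    |m₂ x * m₁ y - m₂ y * m₁ x| ≤ m₁ y * (1 / 2) ^ n := by
  have hzero : ∀ x, m₁ x = 0 → m₂ x = 0 := fun x hx => by
    rw [← map_bot_of_add h₂add]
    exact heq _ _ (hx.trans (map_bot_of_add h₁add).symm)
  induction n generalizing x y with
  | zero =>
    have a₁ := mul_le_of_le_one_left (hnonneg y) (hle x)
    have a₂ := mul_le_of_le_one_left (hnonneg x) (hle y)
    have b₁ := mul_nonneg (hnonneg' x) (hnonneg y)
    have b₂ := mul_nonneg (hnonneg' y) (hnonneg x)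
    rw [abs_le]
    constructor <;> simp only [pow_zero, mul_one] <;> linarith
  | succ n ih =>
    have hpos : 0 ≤ m₁ y * (1 / 2) ^ (n + 1) := mul_nonneg (hnonneg y) (by positivity)
    rcases (hnonneg x).eq_or_lt with hx | hx
    · simpa [← hx, hzero x hx.symm] using hpos
    obtain ⟨k, z, hz, hk₁, hk₂⟩ :=
      exists_common_remainder h₁add h₂add hnonneg heq hdiv hx y
    have hcross : m₂ x * m₁ y - m₂ y * m₁ x = m₂ x * m₁ z - m₂ z * m₁ x := by
      rw [hk₁, hk₂]; ring
    rcases (hnonneg z).eq_or_lt with hz0 | hz0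
    · simpa [hcross, ← hz0, hzero z hz0.symm] using hpos
    obtain ⟨l, w, hw, hl₁, hl₂⟩ :=
      exists_common_remainder h₁add h₂add hnonneg heq hdiv hz0 x
    have hcross' : m₂ x * m₁ z - m₂ z * m₁ x = m₂ w * m₁ z - m₂ z * m₁ w := by
      rw [hl₁, hl₂]; ring
    have hk : (1 : ℝ) ≤ k := by
      rcases Nat.eq_zero_or_pos k with rfl | hk
      · simp only [Nat.cast_zero, zero_mul, zero_add] at hk₁
        linarith
      · exact_mod_cast hk
    have hhalf : m₁ z ≤ m₁ y * (1 / 2) := by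
      have := mul_le_mul_of_nonneg_right hk hx.le
      linarith
    rw [hcross, hcross']
    calc _ ≤ m₁ z * (1 / 2) ^ n := ih hw.le
      _ ≤ m₁ y * (1 / 2) * (1 / 2) ^ n := by gcongr
      _ = m₁ y * (1 / 2) ^ (n + 1) := by ring

end FinitelyAdditive

theorem stmt_19 {A L : Type*} [BooleanAlgebra A] [LinearOrder L] (ρ : A → L)
    (h : IsBasicScaling ρ) (hdiv : Divided ρ)
    (harch : ¬ ∃ (y : A) (X : Set A), ρ ⊥ < ρ y ∧ X.Infinite ∧
      X.Pairwise (fun x x' => x ⊓ x' = ⊥) ∧ ∀ x ∈ X, ρ y ≤ ρ x)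
    (m₁ m₂ : A → ℝ)
    (h₁top : m₁ ⊤ = 1) (h₂top : m₂ ⊤ = 1)
    (h₁add : ∀ x y : A, x ⊓ y = ⊥ → m₁ (x ⊔ y) = m₁ x + m₁ y)
    (h₂add : ∀ x y : A, x ⊓ y = ⊥ → m₂ (x ⊔ y) = m₂ x + m₂ y)
    (h₁ord : ∀ x y : A, m₁ x ≤ m₁ y ↔ ρ x ≤ ρ y)
    (h₂ord : ∀ x y : A, m₂ x ≤ m₂ y ↔ ρ x ≤ ρ y) :
    m₁ = m₂ := by
  have hmono : Monotone ρ := fun x y hxy => by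
    rcases hxy.eq_or_lt with rfl | hlt
    · exact le_rfl
    · exact (h.mono x y hlt).le
  have hnonneg₁ : ∀ x, 0 ≤ m₁ x := fun x => by
    rw [← map_bot_of_add h₁add]
    exact (h₁ord _ _).2 (hmono bot_le)
  have hnonneg₂ : ∀ x, 0 ≤ m₂ x := fun x => by
    rw [← map_bot_of_add h₂add]
    exact (h₂ord _ _).2 (hmono bot_le)
  have hle₂ : ∀ x, m₂ x ≤ 1 := fun x => by
    rw [← h₂top]
    exact (h₂ord _ _).2 (hmono le_top)
  have heq : ∀ x y, m₁ x = m₁ y → m₂ x = m₂ y := fun x y hxy =>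
    le_antisymm ((h₂ord _ _).2 ((h₁ord _ _).1 hxy.le))
      ((h₂ord _ _).2 ((h₁ord _ _).1 hxy.ge))
  have hdiv₁ : ∀ x y, m₁ x < m₁ y → ∃ y' ≤ y, m₁ y' = m₁ x := fun x y hxy => by
    rw [← not_le, h₁ord, not_le] at hxy
    obtain ⟨y', hy', he⟩ := hdiv x y hxy
    exact ⟨y', hy'.le, le_antisymm ((h₁ord _ _).2 he.le) ((h₁ord _ _).2 he.ge)⟩
  funext x
  have hbound : ∀ n : ℕ, |m₂ x - m₁ x| ≤ (1 / 2) ^ n := fun n => by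
    simpa [h₁top, h₂top] using abs_cross_sub_le h₁add h₂add hnonneg₁ hnonneg₂ hle₂ heq hdiv₁ n
      ((h₁ord x ⊤).2 (hmono le_top))
  have hlim : |m₂ x - m₁ x| ≤ 0 :=
    ge_of_tendsto' (tendsto_pow_atTop_nhds_zero_of_lt_one (by norm_num) (by norm_num)) hbound
  exact (sub_eq_zero.1 (abs_nonpos_iff.1 hlim)).symm
end
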